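/- Rational solutions of Painlevé IV from generalized Hermite polynomials: let λ ≥ 1 and μ ≥ 1 be integers, let h₁(t) = W(H_λ, H_{λ+1}, …, H_{λ+μ−1})(t) and h₂(t) = W(H_{λ−1}, H_λ, …, H_{λ+μ−2})(t), and define y(t) = (d/dt) log(h₁(t)/h₂(t)). Then at every t ∈ ℝ with h₁(t) ≠ 0, h₂(t) ≠ 0 and y(t) ≠ 0, y satisfies the Painlevé IV equation y″ = (y′)²/(2y) + (3/2)y³ + 4t·y² + 2(t² − a)·y + b/y with parameters a = 2λ + μ − 1 and b = −2μ². -/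

import Mathlib

/-- The physicists' Hermite polynomials:
`H₀ = 1`, `H₁ = 2x`, `H_{n+1} = 2x·H_n − 2n·H_{n-1}`. -/
noncomputable def hermiteH : ℕ → Polynomial ℝ
  | 0 => 1
  | 1 => Polynomial.C 2 * Polynomial.X
  | n + 2 => Polynomial.C 2 * Polynomial.X * hermiteH (n + 1)
      - Polynomial.C (2 * ((n : ℝ) + 1)) * hermiteH n

/-- The Wronskian of a list of functions: the determinant of the matrix whose
`(i, j)` entry is the `i`-th derivative of the `j`-th function (0-indexed);
the empty Wronskian is `1`. -/
noncomputable def wronskian (fs : List (ℝ → ℝ)) (z : ℝ) : ℝ :=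
  Matrix.det (Matrix.of fun i j : Fin fs.length => iteratedDeriv i.val (fs.get j) z)

section

open Polynomial

/-- The Wronskian determinant of a tuple with respect to an abstract derivative `D`. -/
noncomputable def wronskianDet {R : Type*} [CommRing R] (D : R → R) {n : ℕ} (F : Fin n → R) : R :=
  Matrix.det (Matrix.of fun i j : Fin n => D^[i.val] (F j))

theorem map_wronskianDet {R S : Type*} [CommRing R] [CommRing S] (φ : R →+* S) {D : R → R}
    {D' : S → S} (h : ∀ x, φ (D x) = D' (φ x)) {n : ℕ} (F : Fin n → R) :
    φ (wronskianDet D F) = wronskianDet D' (fun j => φ (F j)) := by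
  unfold wronskianDet
  rw [RingHom.map_det]
  congr 1
  ext i j
  simpa using (Function.Semiconj.iterate_right (f := φ) h i.val) (F j)

theorem wronskianDet_snoc {R : Type*} [CommRing R] (D : R → R) {n : ℕ} (F : Fin n → R) (g : R) :
    wronskianDet D (Fin.snoc F g : Fin (n + 1) → R)
      = (-1) ^ n * wronskianDet D (Fin.cons g F : Fin (n + 1) → R) := by
  unfold wronskianDet
  rw [Fin.snoc_eq_cons_rotate]
  have := Matrix.det_permute' (finRotate (n + 1))
    (Matrix.of fun i j : Fin (n + 1) => D^[i.val] ((Fin.cons g F : Fin (n + 1) → R) j))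
  rw [sign_finRotate] at this
  push_cast at this
  rw [← this]
  rfl

section Derivation

variable {K : Type*} [Field K] (D : Derivation ℤ K K)

theorem Derivation.exists_coeff_iterate_mul (c : K) (i : ℕ) :
    ∃ a : ℕ → K, a i = c ∧ (∀ k, i < k → a k = 0) ∧
      ∀ f : K, D^[i] (c * f) = ∑ k ∈ Finset.range (i + 1), a k * D^[k] f := by
  induction i with
  | zero =>
    refine ⟨fun k => if k = 0 then c else 0, by simp, ?_, by simp⟩
    intro k hk
    simp [hk.ne']
  | succ i ih =>
    obtain ⟨a, ha, ha0, haf⟩ := ih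
    refine ⟨fun k => D (a k) + (if k = 0 then 0 else a (k - 1)), ?_, ?_, ?_⟩
    · simp [ha, ha0 (i + 1) (by omega)]
    · intro k hk
      have h0 : k ≠ 0 := by omega
      simp [h0, ha0 k (by omega), ha0 (k - 1) (by omega)]
    · intro f
      rw [Function.iterate_succ_apply', haf, map_sum]
      simp only [Derivation.leibniz, smul_eq_mul, Finset.sum_add_distrib, add_mul]
      rw [Finset.sum_range_succ (fun k => D (a k) * _),
        Finset.sum_range_succ' (fun k => (if k = 0 then 0 else a (k - 1)) * _)]
      simp only [ha0 (i + 1) (by omega), Function.iterate_succ_apply']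
      simp [mul_comm, add_comm]

theorem wronskianDet_mul_left (c : K) {n : ℕ} (F : Fin n → K) :
    wronskianDet D (fun j => c * F j) = c ^ n * wronskianDet D F := by
  choose a ha ha0 haf using D.exists_coeff_iterate_mul c
  have hM : (Matrix.of fun i j : Fin n => D^[i.val] (c * F j))
      = (Matrix.of fun i k : Fin n => a i.val k.val) *
        Matrix.of fun i j : Fin n => D^[i.val] (F j) := by
    ext i j
    simp only [Matrix.mul_apply, Matrix.of_apply]
    rw [haf, Fin.sum_univ_eq_sum_range (fun k => a i k * D^[k] (F j)) n]
    apply Finset.sum_subset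
    · intro k hk
      simp only [Finset.mem_range] at hk ⊢
      omega
    · intro k _ hk
      simp only [Finset.mem_range] at hk
      rw [ha0 _ _ (by omega), zero_mul]
  unfold wronskianDet
  rw [hM, Matrix.det_mul, Matrix.det_of_isLowerTriangular]
  · simp [ha]
  · intro i k hik
    exact ha0 _ _ (by simpa using hik)

theorem wronskianDet_cons_one {n : ℕ} (F : Fin n → K) :
    wronskianDet D (Fin.cons 1 F : Fin (n + 1) → K) = wronskianDet D (fun j => D (F j)) := by
  have h1 : ∀ i : ℕ, D^[i + 1] (1 : K) = 0 := by
    intro i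
    rw [Function.iterate_succ_apply, Derivation.map_one_eq_zero, iterate_map_zero]
  unfold wronskianDet
  rw [Matrix.det_succ_column_zero, Fin.sum_univ_succ]
  simp only [Matrix.of_apply, Fin.cons_zero, Fin.val_succ, h1]
  simp only [Fin.val_zero, pow_zero, Function.iterate_zero, id_eq, mul_one, one_mul, mul_zero,
    zero_mul, Finset.sum_const_zero, add_zero]
  congr 1

/-- Darboux reduction of a Wronskian: the first function is eliminated. -/
theorem wronskianDet_cons {n : ℕ} {f : K} (hf : f ≠ 0) (F : Fin n → K) :
    wronskianDet D (Fin.cons f F : Fin (n + 1) → K)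
      = f * wronskianDet D (fun j => D (F j) - D f / f * F j) := by
  have h : (Fin.cons f F : Fin (n + 1) → K)
      = fun j => f * (Fin.cons 1 (fun j => f⁻¹ * F j) : Fin (n + 1) → K) j := by
    ext j
    refine Fin.cases ?_ (fun i => ?_) j
    · simp
    · simp [hf]
  have h2 : (fun j => D (f⁻¹ * F j)) = fun j => f⁻¹ * (D (F j) - D f / f * F j) := by
    ext j
    rw [Derivation.leibniz, Derivation.leibniz_inv]
    simp only [smul_eq_mul]
    field_simp
    ring
  rw [h, wronskianDet_mul_left, wronskianDet_cons_one, h2, wronskianDet_mul_left, inv_pow, pow_succ]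
  generalize (wronskianDet D fun j => D (F j) - D f / f * F j) = w
  field_simp

/-- Hirota-type bilinear expression `(D² - 2 z D + c) Q·P`. -/
def bilinearForm (z c Q P : K) : K :=
  D (D Q) * P - 2 * D Q * D P + Q * D (D P) - 2 * z * (D Q * P - Q * D P) + c * Q * P

theorem bilinearForm_mul_mul (z c f Q P : K) (hf : f ≠ 0) :
    bilinearForm D z c (f * Q) (f * P)
      = f ^ 2 * bilinearForm D z (c + 2 * D (D f / f)) Q P := by
  unfold bilinearForm
  rw [Derivation.leibniz_div]
  simp only [Derivation.leibniz, smul_eq_mul, map_add]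
  field_simp
  ring

theorem bilinearForm_const_mul (z c k Q P : K) (hk : D k = 0) :
    bilinearForm D z c (k * Q) P = k * bilinearForm D z c Q P := by
  unfold bilinearForm
  simp only [Derivation.leibniz, smul_eq_mul, map_add, hk, map_zero]
  ring

/-- Crum's theorem for iterated Darboux transformations of `D² f - 2 z D f + (U + 2 k) f = 0`:
Wronskians of solutions with distinct eigenvalues are nonzero and appending one more solution
gives a bilinear equation. -/
theorem wronskianDet_crum [CharZero K] {z : K} (hz : D z = 1) :
    ∀ {n : ℕ} (U : K) (F : Fin n → K) (k : Fin n → ℕ) (g : K) (l : ℕ),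
      (∀ j, F j ≠ 0) → (∀ j, D (D (F j)) - 2 * z * D (F j) + (U + 2 * k j) * F j = 0) →
      g ≠ 0 → D (D g) - 2 * z * D g + (U + 2 * l) * g = 0 →
      Function.Injective k → (∀ j, k j ≠ l) →
      wronskianDet D F ≠ 0 ∧ wronskianDet D (Fin.snoc F g : Fin (n + 1) → K) ≠ 0 ∧
        bilinearForm D z (U + 2 * l - 2 * n) (wronskianDet D (Fin.snoc F g : Fin (n + 1) → K))
          (wronskianDet D F) = 0 := by
  intro n
  induction n with
  | zero =>
    intro U F k g l _ _ hg hgl _ _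
    have h0 : wronskianDet D F = 1 := by simp [wronskianDet]
    have h1 : wronskianDet D (Fin.snoc F g : Fin 1 → K) = g := by
      simp [wronskianDet, Fin.snoc]
    rw [h0, h1]
    refine ⟨one_ne_zero, hg, ?_⟩
    simp only [bilinearForm, Derivation.map_one_eq_zero, map_zero, Nat.cast_zero]
    linear_combination hgl
  | succ n ih =>
    intro U F k g l hF hFk hg hgl hk hkl
    have hF0 : F = (Fin.cons (F 0) (Fin.tail F) : Fin (n + 1) → K) := (Fin.cons_self_tail F).symm
    set f := F 0 with hf_def
    have hf : f ≠ 0 := hF 0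
    have hfk := hFk 0
    rw [← hf_def] at hfk
    set ρ := D f / f with hρ
    have hDf : D f = ρ * f := by rw [hρ]; field_simp
    have hDρ : D ρ = - ρ ^ 2 + 2 * z * ρ - (U + 2 * k 0) := by
      have : D (D f) = D ρ * f + ρ * (ρ * f) := by
        rw [hDf, Derivation.leibniz, hDf]; simp only [smul_eq_mul]; ring
      rw [this, hDf] at hfk
      apply mul_right_cancel₀ hf
      linear_combination hfk
    have hnat : ∀ m : ℕ, D (m : K) = 0 := fun m => D.map_natCast m
    have h2 : D (2 : K) = 0 := by exact_mod_cast hnat 2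
    have hDDρ : D (D ρ) = - 2 * ρ * D ρ + 2 * ρ + 2 * z * D ρ - D U := by
      rw [hDρ]
      simp only [map_sub, map_add, map_neg, Derivation.leibniz, Derivation.leibniz_pow, smul_eq_mul,
        h2, hnat, hz]
      rw [hDρ]
      simp
      ring
    have key : ∀ (h : K) (m : ℕ), D (D h) - 2 * z * D h + (U + 2 * m) * h = 0 →
        D (D (D h - ρ * h)) - 2 * z * D (D h - ρ * h)
          + ((U + 2 * D ρ - 2) + 2 * m) * (D h - ρ * h) = 0 := by
      intro h m hm
      have e2 : D (D h) = 2 * z * D h - (U + 2 * m) * h := by linear_combination hm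
      have e3 : D (D (D h)) = 2 * D h + 2 * z * D (D h) - D U * h - (U + 2 * m) * D h := by
        rw [e2]
        simp only [map_sub, map_add, Derivation.leibniz, smul_eq_mul, h2, hnat, hz]
        rw [e2]
        ring
      simp only [map_sub, map_add, Derivation.leibniz, smul_eq_mul]
      rw [e3, hDDρ, e2, hDρ]
      ring
    have key0 : ∀ (h : K) (m : ℕ), h ≠ 0 → D (D h) - 2 * z * D h + (U + 2 * m) * h = 0 →
        k 0 ≠ m → D h - ρ * h ≠ 0 := by
      intro h m hh hm hkm h0
      have e1 : D h = ρ * h := by linear_combination h0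
      have e2 : D (D h) = D ρ * h + ρ * (ρ * h) := by
        rw [e1, Derivation.leibniz, e1]; simp only [smul_eq_mul]; ring
      rw [e2, e1, hDρ] at hm
      have : (2 : K) * ((m : K) - k 0) * h = 0 := by linear_combination hm
      have h3 : (m : K) - k 0 = 0 := by simpa [hh] using this
      exact hkm (by exact_mod_cast (sub_eq_zero.mp h3).symm)
    have hsnoc : (Fin.snoc F g : Fin (n + 1 + 1) → K)
        = (Fin.cons f (Fin.snoc (Fin.tail F) g : Fin (n + 1) → K) : Fin (n + 1 + 1) → K) := by
      conv_lhs => rw [hF0]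
      rw [Fin.cons_snoc_eq_snoc_cons]
    have hsnoc' : (fun j => D ((Fin.snoc (Fin.tail F) g : Fin (n + 1) → K) j)
          - D f / f * (Fin.snoc (Fin.tail F) g : Fin (n + 1) → K) j)
        = (Fin.snoc (fun j => D (Fin.tail F j) - ρ * Fin.tail F j) (D g - ρ * g)
            : Fin (n + 1) → K) := by
      ext j
      refine Fin.lastCases ?_ (fun i => ?_) j <;> simp [hρ]
    obtain ⟨hP, hQ, hPQ⟩ := ih (U + 2 * D ρ - 2) (fun j => D (Fin.tail F j) - ρ * Fin.tail F j)
      (Fin.tail k) (D g - ρ * g) l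
      (fun j => key0 _ _ (hF j.succ) (hFk j.succ) (fun h => (Fin.succ_ne_zero j) (hk h).symm))
      (fun j => key _ _ (hFk j.succ)) (key0 _ _ hg hgl (hkl 0)) (key _ _ hgl)
      (hk.comp (Fin.succ_injective n)) (fun j => hkl j.succ)
    have eP : wronskianDet D F
        = f * wronskianDet D (fun j => D (Fin.tail F j) - ρ * Fin.tail F j) := by
      conv_lhs => rw [hF0]
      rw [wronskianDet_cons D hf]
    rw [eP, hsnoc, wronskianDet_cons D hf, hsnoc', bilinearForm_mul_mul D _ _ _ _ _ hf]
    refine ⟨mul_ne_zero hf hP, mul_ne_zero hf hQ, ?_⟩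
    rw [mul_eq_zero]
    right
    rw [← hPQ]
    congr 1
    push_cast
    ring

/-- Logarithmic form of a bilinear equation. -/
theorem logDeriv_eq_of_bilinearForm_eq_zero {z c Q P : K} (hQ : Q ≠ 0) (hP : P ≠ 0)
    (h : bilinearForm D z c Q P = 0) :
    D (D Q / Q) + D (D P / P) + (D Q / Q - D P / P) ^ 2 - 2 * z * (D Q / Q - D P / P) + c = 0 := by
  unfold bilinearForm at h
  rw [Derivation.leibniz_div, Derivation.leibniz_div]
  simp only [smul_eq_mul]
  field_simp
  linear_combination Q * P * h

/-- Three bilinear equations on a triangle of tau functions give the Painlevé IV equation. -/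
theorem painleveIV_of_bilinearForm [CharZero K] {z : K} (hz : D z = 1) {A B V : K} (hA : A ≠ 0)
    (hB : B ≠ 0) (hV : V ≠ 0) (n m : ℕ)
    (h1 : bilinearForm D z (2 * m - 2 - 2 * n) V A = 0)
    (h2 : bilinearForm D z (2 * m - 2) V B = 0)
    (h3 : bilinearForm D z (-2 * n) B A = 0) (y : K) (hy : y = D A / A - D B / B) :
    2 * y * D (D y) = D y ^ 2 + 3 * y ^ 4 + 8 * z * y ^ 3
      + 4 * (z ^ 2 - (2 * m + n - 1)) * y ^ 2 - 4 * n ^ 2 := by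
  replace h1 := logDeriv_eq_of_bilinearForm_eq_zero D hV hA h1
  replace h2 := logDeriv_eq_of_bilinearForm_eq_zero D hV hB h2
  replace h3 := logDeriv_eq_of_bilinearForm_eq_zero D hB hA h3
  generalize D A / A = u at *
  generalize D B / B = w at *
  generalize D V / V = v at *
  obtain ⟨S, hS⟩ : ∃ S, S = 2 * v - u - w := ⟨_, rfl⟩
  have h20 : D (2 : K) = 0 := by exact_mod_cast D.map_natCast 2
  have hn : D (n : K) = 0 := D.map_natCast n
  have hDS : D S = 2 * D v - D u - D w := by
    rw [hS]; simp [Derivation.leibniz, h20]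
  have hDy' : D y = D u - D w := by rw [hy, map_sub]
  have hDy : D y = y * S - 2 * z * y + 2 * n := by
    rw [hDy', hy, hS]; linear_combination h1 - h2
  have hS' : 2 * D S = 3 * y ^ 2 + 8 * z * y - S ^ 2 + 4 * z * S - 8 * (m - 1) - 4 * n := by
    rw [hDS, hS, hy]
    linear_combination 2 * h1 + 2 * h2 - 4 * h3
  have hDDy : D (D y) = D y * S + y * D S - 2 * y - 2 * z * D y := by
    rw [hDy]
    simp only [map_sub, map_add, Derivation.leibniz, smul_eq_mul, h20, hn, hz]
    rw [hDy]
    ring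
  rw [hDDy]
  linear_combination y ^ 2 * hS' - (D y - y * S + 2 * z * y + 2 * n) * hDy

end Derivation

section FractionField

variable (K : Type*) [Field K] [Algebra ℝ[X] K]

/-- The ring homomorphism `p ↦ p + p' ε` into dual numbers over a field of fractions. -/
noncomputable def dualNumberTaylor : ℝ[X] →+* DualNumber K where
  toFun p :=
    TrivSqZeroExt.inl (algebraMap _ _ p) + TrivSqZeroExt.inr (algebraMap _ _ (derivative p))
  map_zero' := by simp
  map_one' := by
    ext
    · simp only [TrivSqZeroExt.fst_add, TrivSqZeroExt.fst_inl, TrivSqZeroExt.fst_inr, map_one,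
        TrivSqZeroExt.fst_one, add_zero]
    · simp only [TrivSqZeroExt.snd_add, TrivSqZeroExt.snd_inl, TrivSqZeroExt.snd_inr,
        derivative_one, map_zero, TrivSqZeroExt.snd_one, add_zero]
  map_add' p q := by
    ext
    · simp only [TrivSqZeroExt.fst_add, TrivSqZeroExt.fst_inl, TrivSqZeroExt.fst_inr, map_add,
        add_zero]
    · simp only [TrivSqZeroExt.snd_add, TrivSqZeroExt.snd_inl, TrivSqZeroExt.snd_inr, map_add,
        zero_add]
  map_mul' p q := by
    ext
    · simp only [TrivSqZeroExt.fst_add, TrivSqZeroExt.fst_inl, TrivSqZeroExt.fst_inr, map_mul,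
        TrivSqZeroExt.fst_mul, add_zero]
    · simp only [TrivSqZeroExt.snd_add, TrivSqZeroExt.snd_inl, TrivSqZeroExt.snd_inr, map_mul,
        TrivSqZeroExt.snd_mul, TrivSqZeroExt.fst_add, TrivSqZeroExt.fst_inl,
        TrivSqZeroExt.fst_inr, derivative_mul, map_add, smul_eq_mul, MulOpposite.smul_eq_mul_unop,
        MulOpposite.unop_op]
      ring

theorem fst_dualNumberTaylor (p : ℝ[X]) :
    (dualNumberTaylor K p).fst = algebraMap ℝ[X] K p := by
  change (TrivSqZeroExt.inl _ + TrivSqZeroExt.inr _ : DualNumber K).fst = _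
  simp only [TrivSqZeroExt.fst_add, TrivSqZeroExt.fst_inl, TrivSqZeroExt.fst_inr, add_zero]

theorem snd_dualNumberTaylor (p : ℝ[X]) :
    (dualNumberTaylor K p).snd = algebraMap ℝ[X] K (derivative p) := by
  change (TrivSqZeroExt.inl _ + TrivSqZeroExt.inr _ : DualNumber K).snd = _
  simp only [TrivSqZeroExt.snd_add, TrivSqZeroExt.snd_inl, TrivSqZeroExt.snd_inr, zero_add]

theorem exists_derivation_fractionField [IsFractionRing ℝ[X] K] :
    ∃ D : Derivation ℤ K K, ∀ p : ℝ[X], D (algebraMap _ _ p) = algebraMap _ _ (derivative p) := by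
  have hu : ∀ p : nonZeroDivisors ℝ[X], IsUnit (dualNumberTaylor K p) := by
    intro p
    rw [TrivSqZeroExt.isUnit_iff_isUnit_fst, fst_dualNumberTaylor]
    exact IsLocalization.map_units K p
  let φ : K →+* DualNumber K := IsLocalization.lift hu
  have hφ : ∀ p : ℝ[X], φ (algebraMap _ _ p) = dualNumberTaylor K p := fun p =>
    IsLocalization.lift_eq hu p
  have hfst : ∀ x, (φ x).fst = x := by
    have : ((TrivSqZeroExt.fstHom ℤ K K : DualNumber K →ₐ[ℤ] K) : DualNumber K →+* K).comp φ
        = RingHom.id _ := by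
      apply IsLocalization.ringHom_ext (nonZeroDivisors ℝ[X])
      apply RingHom.ext
      intro p
      change (φ (algebraMap _ _ p)).fst = algebraMap _ _ p
      rw [hφ, fst_dualNumberTaylor]
    exact fun x => DFunLike.congr_fun this x
  refine ⟨Derivation.mk' (AddMonoidHom.toIntLinearMap
    { toFun := fun x => (φ x).snd, map_zero' := by simp, map_add' := by simp }) ?_, ?_⟩
  · intro a b
    change (φ (a * b)).snd = a * (φ b).snd + b * (φ a).snd
    rw [map_mul, TrivSqZeroExt.snd_mul, hfst, hfst, mul_comm b]
    rfl
  · intro p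
    change (φ _).snd = _
    rw [hφ, snd_dualNumberTaylor]

end FractionField

theorem derivative_hermiteH_succ (n : ℕ) :
    derivative (hermiteH (n + 1)) = C (2 * ((n : ℝ) + 1)) * hermiteH n := by
  induction n using Nat.strong_induction_on with
  | _ n ih =>
    match n with
    | 0 => simp [hermiteH]
    | 1 =>
      simp [hermiteH]
      ring
    | n + 2 =>
      rw [hermiteH]
      simp only [derivative_sub, derivative_mul, derivative_C, derivative_X, zero_mul, zero_add,
        mul_one, ih (n + 1) (by omega), ih n (by omega)]
      rw [hermiteH]
      push_cast
      simp only [C_mul, C_add, map_natCast, map_one]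
      simp only [show (C 2 : ℝ[X]) = 2 from rfl]
      ring

theorem hermiteH_ne_zero (n : ℕ) : hermiteH n ≠ 0 := by
  induction n with
  | zero => simp [hermiteH]
  | succ n ih =>
    intro h
    have := derivative_hermiteH_succ n
    rw [h, derivative_zero] at this
    have h2 : (2 * ((n : ℝ) + 1)) ≠ 0 := by positivity
    exact mul_ne_zero (C_ne_zero.mpr h2) ih this.symm

theorem hermiteH_differential_equation (n : ℕ) :
    derivative (derivative (hermiteH n)) - 2 * X * derivative (hermiteH n)
      + 2 * (n : ℝ[X]) * hermiteH n = 0 := by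
  match n with
  | 0 => simp [hermiteH]
  | 1 => simp [hermiteH]; simp only [show (C 2 : ℝ[X]) = 2 from rfl]; ring
  | n + 2 =>
    rw [derivative_hermiteH_succ, derivative_mul, derivative_hermiteH_succ, hermiteH]
    push_cast
    simp only [C_mul, C_add, map_natCast, map_one, derivative_C, derivative_mul,
      derivative_add, derivative_natCast, derivative_one]
    simp only [show (C 2 : ℝ[X]) = 2 from rfl]
    simp
    ring

theorem iteratedDeriv_polynomial_eval (p : ℝ[X]) (i : ℕ) :
    iteratedDeriv i (fun x => p.eval x) = fun x => (derivative^[i] p).eval x := by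
  induction i generalizing p with
  | zero => simp
  | succ i ih =>
    rw [iteratedDeriv_succ', Function.iterate_succ_apply, ← ih]
    congr 1
    ext x
    exact p.deriv

theorem wronskian_map_range_eq_eval (p : ℕ → ℝ[X]) (n : ℕ) (t : ℝ) :
    _root_.wronskian ((List.range n).map fun i => fun x => (p i).eval x) t
      = (wronskianDet derivative (fun i : Fin n => p i)).eval t := by
  have hlen : ((List.range n).map fun i => fun x => (p i).eval x).length = n := by simp
  unfold _root_.wronskian wronskianDet
  rw [← coe_evalRingHom, RingHom.map_det, ← Matrix.det_submatrix_equiv_self (finCongr hlen)]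
  congr 1
  ext i j
  simp [iteratedDeriv_polynomial_eval]

theorem bilinearForm_eq_zero_of_mul {K : Type*} [Field K] {D : Derivation ℤ K K} {z c k Q P : K}
    (hk : k ≠ 0) (hDk : D k = 0) (h : bilinearForm D z c (k * Q) P = 0) :
    bilinearForm D z c Q P = 0 := by
  rw [bilinearForm_const_mul D _ _ _ _ _ hDk] at h
  exact (mul_eq_zero.mp h).resolve_left hk

/-- The Painlevé IV equation for generalized Hermite polynomials with denominators cleared. -/
theorem hermiteH_wronskianDet_painleveIV (l n : ℕ) (hl : 1 ≤ l) (A B N N₁ N₂ E : ℝ[X])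
    (hA : A = wronskianDet derivative (fun i : Fin n => hermiteH (l + i)))
    (hB : B = wronskianDet derivative (fun i : Fin n => hermiteH (l - 1 + i)))
    (hE : E = A * B) (hN : N = derivative A * B - A * derivative B)
    (hN₁ : N₁ = derivative N * E - N * derivative E)
    (hN₂ : N₂ = derivative N₁ * E - 2 * N₁ * derivative E) :
    2 * N * N₂ = N₁ ^ 2 + 3 * N ^ 4 + 8 * X * N ^ 3 * E
      + 4 * (X ^ 2 - (2 * (l : ℝ[X]) + (n : ℝ[X]) - 1)) * N ^ 2 * E ^ 2
      - 4 * (n : ℝ[X]) ^ 2 * E ^ 4 := by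
  obtain ⟨l, rfl⟩ : ∃ m, l = m + 1 := ⟨l - 1, by omega⟩
  simp only [Nat.add_sub_cancel] at hB
  obtain ⟨K, _, _, _⟩ : ∃ (K : Type) (_ : Field K) (_ : Algebra ℝ[X] K), IsFractionRing ℝ[X] K :=
    ⟨FractionRing ℝ[X], inferInstance, inferInstance, inferInstance⟩
  obtain ⟨D, hD⟩ := exists_derivation_fractionField K
  have hinj : Function.Injective (algebraMap ℝ[X] K) := IsFractionRing.injective ℝ[X] K
  have : CharZero K := charZero_of_injective_algebraMap hinj
  set ι := algebraMap ℝ[X] K with hι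
  set z := ι X with hz
  have hDz : D z = 1 := by rw [hz, hD, derivative_X, map_one]
  have hW : ∀ {m : ℕ} (F : Fin m → ℝ[X]),
      ι (wronskianDet derivative F) = wronskianDet D (fun j => ι (F j)) :=
    fun F => map_wronskianDet ι (fun p => (hD p).symm) F
  set H : ℕ → K := fun k => ι (hermiteH k) with hH
  have hH0 : ∀ k, H k ≠ 0 := fun k => by
    simpa [hH] using (map_ne_zero_iff ι hinj).mpr (hermiteH_ne_zero k)
  have hHk : ∀ k, D (D (H k)) - 2 * z * D (H k) + (0 + 2 * k) * H k = 0 := fun k => by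
    have := congrArg ι (hermiteH_differential_equation k)
    simp only [map_add, map_sub, map_mul, map_natCast, map_ofNat, map_zero] at this
    simp only [hH, hD, zero_add]
    exact this
  have hsign : ((-1 : K) ^ n) ≠ 0 := pow_ne_zero _ (by simp)
  have hDsign : D ((-1 : K) ^ n) = 0 := by
    have := D.map_intCast ((-1) ^ n)
    push_cast at this
    exact this
  set V := wronskianDet D (fun i : Fin (n + 1) => H (l + i)) with hV
  have hιA : ι A = wronskianDet D (fun i : Fin n => H (l + 1 + i)) := by rw [hA, hW]
  have hιB : ι B = wronskianDet D (fun i : Fin n => H (l + i)) := by rw [hB, hW]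
  have hcons : (Fin.cons (H l) (fun i : Fin n => H (l + 1 + i)) : Fin (n + 1) → K)
      = fun i : Fin (n + 1) => H (l + i) := by
    ext i
    refine Fin.cases ?_ (fun i => ?_) i
    · simp
    · simp only [Fin.cons_succ, Fin.val_succ]
      congr 1
      omega
  have hsnoc : (Fin.snoc (fun i : Fin n => H (l + i)) (H (l + n)) : Fin (n + 1) → K)
      = fun i : Fin (n + 1) => H (l + i) := by
    ext i
    refine Fin.lastCases ?_ (fun i => ?_) i <;> simp
  have c1 := wronskianDet_crum D hDz 0 (fun i : Fin n => H (l + 1 + i)) (fun i => l + 1 + i) (H l) l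
    (fun _ => hH0 _) (fun _ => hHk _) (hH0 _) (hHk _)
    (fun i j hij => Fin.ext (by simpa using hij)) (fun j => by omega)
  have c2 := wronskianDet_crum D hDz 0 (fun i : Fin n => H (l + i)) (fun i => l + i) (H (l + n))
    (l + n) (fun _ => hH0 _) (fun _ => hHk _) (hH0 _) (hHk _)
    (fun i j hij => Fin.ext (by simpa using hij)) (fun j => by omega)
  have c3 := wronskianDet_crum D hDz 0 (fun i : Fin n => H (l + 1 + i)) (fun i => l + 1 + i) (H 0) 0
    (fun _ => hH0 _) (fun _ => hHk _) (hH0 _) (hHk _)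
    (fun i j hij => Fin.ext (by simpa using hij)) (fun j => by omega)
  have hH1 : H 0 = 1 := by simp [hH, hermiteH]
  set c : ℕ := ∏ i : Fin n, 2 * (l + i + 1) with hc
  have hc0 : (c : K) ≠ 0 := by
    rw [Nat.cast_ne_zero, hc]
    exact Finset.prod_ne_zero_iff.mpr fun i _ => by positivity
  have hder : wronskianDet D (fun i : Fin n => D (H (l + 1 + i))) = c * ι B := by
    have hk : ∀ k : ℕ, D (H (k + 1)) = ((2 * (k + 1) : ℕ) : K) * H k := fun k => by
      have e : (C (2 * ((k : ℝ) + 1)) : ℝ[X]) = ((2 * (k + 1) : ℕ) : ℝ[X]) := by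
        push_cast
        simp only [C_mul, C_add, map_natCast, map_one, map_ofNat]
      simp only [hH, hD]
      rw [derivative_hermiteH_succ, e, map_mul, map_natCast]
    rw [hιB, hc, Nat.cast_prod]
    unfold wronskianDet
    rw [← Matrix.det_mul_row]
    congr 1
    ext i j
    simp only [Matrix.of_apply]
    rw [show l + 1 + (j : ℕ) = l + j + 1 by omega, hk]
    generalize H (l + j) = x
    generalize 2 * (l + (j : ℕ) + 1) = m
    have hcomm : Function.Commute D (fun x : K => (m : K) * x) := fun x => by
      simp [Derivation.leibniz]
    exact hcomm.iterate_left i x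
  rw [wronskianDet_snoc, hcons, ← hV, ← hιA] at c1
  rw [hsnoc, ← hV, ← hιB] at c2
  rw [wronskianDet_snoc, hH1, wronskianDet_cons_one, hder, ← hιA] at c3
  have hιA0 := c1.1
  have hιB0 := c2.1
  have hV0 := c2.2.1
  have b1 := bilinearForm_eq_zero_of_mul hsign hDsign c1.2.2
  have b2 := c2.2.2
  have b3 := bilinearForm_eq_zero_of_mul hc0 (D.map_natCast c)
    (bilinearForm_eq_zero_of_mul hsign hDsign c3.2.2)
  have main := painleveIV_of_bilinearForm D hDz hιA0 hιB0 hV0 n (l + 1)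
    (by rw [← b1]; congr 1; push_cast; ring) (by rw [← b2]; congr 1; push_cast; ring)
    (by rw [← b3]; congr 1; push_cast; ring) _ rfl
  obtain ⟨y, hy⟩ : ∃ y, y = D (ι A) / ι A - D (ι B) / ι B := ⟨_, rfl⟩
  rw [← hy] at main
  have eE : ι E = ι A * ι B := by rw [hE, map_mul]
  have eN : ι N = y * ι E := by
    rw [hN, eE, hy, map_sub, map_mul, map_mul, ← hD, ← hD]
    field_simp
  have eN₁ : ι N₁ = D y * ι E ^ 2 := by
    rw [hN₁, map_sub, map_mul, map_mul, ← hD, ← hD, eN, Derivation.leibniz]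
    simp only [smul_eq_mul]
    ring
  have eN₂ : ι N₂ = D (D y) * ι E ^ 3 := by
    rw [hN₂, map_sub, map_mul, map_mul, map_mul, map_ofNat, ← hD, ← hD, eN₁, Derivation.leibniz,
      Derivation.leibniz_pow]
    simp
    ring
  apply hinj
  simp only [map_add, map_sub, map_mul, map_pow, map_natCast, map_ofNat, map_one]
  rw [eN, eN₁, eN₂, ← hz]
  push_cast at main ⊢
  linear_combination ι E ^ 4 * main

/-- First and second derivatives of the logarithmic derivative of a quotient of polynomials. -/
theorem deriv_log_eval_div_eval (A B N N₁ N₂ E : ℝ[X]) (hE : E = A * B)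
    (hN : N = derivative A * B - A * derivative B)
    (hN₁ : N₁ = derivative N * E - N * derivative E)
    (hN₂ : N₂ = derivative N₁ * E - 2 * N₁ * derivative E) {y : ℝ → ℝ}
    (hy : y = fun t => deriv (fun s => Real.log (A.eval s / B.eval s)) t) {t : ℝ}
    (ht : E.eval t ≠ 0) :
    y t = N.eval t / E.eval t ∧ deriv y t = N₁.eval t / E.eval t ^ 2 ∧
      deriv (deriv y) t = N₂.eval t / E.eval t ^ 3 := by
  have h0 : ∀ s, E.eval s ≠ 0 → y s = N.eval s / E.eval s := by
    intro s hs
    rw [hE, eval_mul] at hs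
    have hA : A.eval s ≠ 0 := left_ne_zero_of_mul hs
    have hB : B.eval s ≠ 0 := right_ne_zero_of_mul hs
    rw [hy]
    have := (((A.hasDerivAt s).div (B.hasDerivAt s) hB).log (div_ne_zero hA hB)).deriv
    simp only [Pi.div_apply] at this
    refine this.trans ?_
    rw [hN, hE]
    simp only [eval_sub, eval_mul]
    field_simp
  have hnhds : ∀ s, E.eval s ≠ 0 → ∀ᶠ r in nhds s, E.eval r ≠ 0 := fun s hs =>
    E.continuous.continuousAt.eventually_ne hs
  have h1 : ∀ s, E.eval s ≠ 0 → deriv y s = N₁.eval s / E.eval s ^ 2 := by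
    intro s hs
    rw [Filter.EventuallyEq.deriv_eq ((hnhds s hs).mono h0)]
    refine ((N.hasDerivAt s).div (E.hasDerivAt s) hs).deriv.trans ?_
    rw [hN₁]
    simp only [eval_sub, eval_mul]
  refine ⟨h0 t ht, h1 t ht, ?_⟩
  rw [Filter.EventuallyEq.deriv_eq ((hnhds t ht).mono h1)]
  refine ((N₁.hasDerivAt t).div ((E.hasDerivAt t).pow 2) (pow_ne_zero 2 ht)).deriv.trans ?_
  rw [hN₂]
  simp only [eval_sub, eval_mul, eval_ofNat, Pi.pow_apply]
  field_simp
  ring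

end

/-- rational solutions of Painlevé IV from generalized Hermite
polynomials: for `λ, μ ≥ 1`, with `h₁ = W(H_λ, …, H_{λ+μ−1})` and
`h₂ = W(H_{λ−1}, …, H_{λ+μ−2})`, the function `y = (log(h₁/h₂))′` satisfies, wherever
`h₁ ≠ 0`, `h₂ ≠ 0` and `y ≠ 0`, the Painlevé IV equation with parameters
`a = 2λ + μ − 1` and `b = −2μ²`. -/
theorem painleveIV_generalized_hermite (lam mu : ℕ) (hlam : 1 ≤ lam) (hmu : 1 ≤ mu)
    (h1 h2 y : ℝ → ℝ)
    (hh1 : h1 = fun t =>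
      wronskian ((List.range mu).map fun i => fun x => (hermiteH (lam + i)).eval x) t)
    (hh2 : h2 = fun t =>
      wronskian ((List.range mu).map fun i => fun x => (hermiteH (lam - 1 + i)).eval x) t)
    (hy : y = fun t => deriv (fun s => Real.log (h1 s / h2 s)) t) :
    ∀ t : ℝ, h1 t ≠ 0 → h2 t ≠ 0 → y t ≠ 0 →
      deriv (deriv y) t =
        (deriv y t) ^ 2 / (2 * y t) + (3 / 2) * (y t) ^ 3 + 4 * t * (y t) ^ 2
          + 2 * (t ^ 2 - (2 * (lam : ℝ) + (mu : ℝ) - 1)) * y t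
          + (-(2 * (mu : ℝ) ^ 2)) / y t := by
  intro t ht1 ht2 hyt
  simp only [wronskian_map_range_eq_eval (fun i => hermiteH (lam + i))] at hh1
  simp only [wronskian_map_range_eq_eval (fun i => hermiteH (lam - 1 + i))] at hh2
  obtain ⟨A, hA⟩ : ∃ A, A = wronskianDet Polynomial.derivative
    (fun i : Fin mu => hermiteH (lam + i)) := ⟨_, rfl⟩
  obtain ⟨B, hB⟩ : ∃ B, B = wronskianDet Polynomial.derivative
    (fun i : Fin mu => hermiteH (lam - 1 + i)) := ⟨_, rfl⟩
  rw [← hA] at hh1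
  rw [← hB] at hh2
  subst hh1 hh2
  obtain ⟨N, hN⟩ : ∃ N, N = Polynomial.derivative A * B - A * Polynomial.derivative B := ⟨_, rfl⟩
  obtain ⟨E, hE⟩ : ∃ E, E = A * B := ⟨_, rfl⟩
  obtain ⟨N₁, hN₁⟩ : ∃ N₁, N₁ = Polynomial.derivative N * E - N * Polynomial.derivative E :=
    ⟨_, rfl⟩
  obtain ⟨N₂, hN₂⟩ : ∃ N₂, N₂ = Polynomial.derivative N₁ * E - 2 * N₁ * Polynomial.derivative E :=
    ⟨_, rfl⟩
  have hEt : E.eval t ≠ 0 := by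
    rw [hE, Polynomial.eval_mul]
    exact mul_ne_zero ht1 ht2
  obtain ⟨e0, e1, e2⟩ := deriv_log_eval_div_eval A B N N₁ N₂ E hE hN hN₁ hN₂ hy hEt
  have main := congrArg (Polynomial.eval t)
    (hermiteH_wronskianDet_painleveIV lam mu hlam A B N N₁ N₂ E hA hB hE hN hN₁ hN₂)
  simp only [Polynomial.eval_add, Polynomial.eval_sub, Polynomial.eval_mul, Polynomial.eval_pow,
    Polynomial.eval_natCast, Polynomial.eval_ofNat, Polynomial.eval_X, Polynomial.eval_one] at main
  have hNt : N.eval t ≠ 0 := by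
    intro h
    rw [e0, h, zero_div] at hyt
    exact hyt rfl
  rw [e0, e1, e2]
  field_simp
  linear_combination main
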